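/- Let L > 0 and h₀ > 0 be real numbers and let j ≥ 1 be an integer; set λ = j(j+1) and λ' = (j+1)(j+2). Then the supremum, over all smooth functions h : [0,L] → ℝ with h(t) > 0 for all t ∈ [0,L), h(L) = 0, h'(L) = −1, and h(0) = h₀, of the gap σ_rev(λ',h,L) − σ_rev(λ,h,L), equals L(λ'−λ)/h₀². (This is the sharpness part of the paper's spectral gap Theorem for metrics of revolution.) -/

import Mathlib

open Set intervalIntegral

/-- The revolution Steklov–Rayleigh infimum `σ_rev(λ, h, L)`: the infimum, over
continuously differentiable `a : ℝ → ℝ` with `a 0 = 1` and `a L = 0`, of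
`(1 / h(0)²) ∫₀ᴸ (a'(t)² h(t)² + λ a(t)²) dt`. -/
noncomputable def steklovRayleighRev (lam L : ℝ) (h : ℝ → ℝ) : ℝ :=
  sInf { x : ℝ | ∃ a : ℝ → ℝ, ContDiff ℝ 1 a ∧ a 0 = 1 ∧ a L = 0 ∧
    x = (1 / (h 0) ^ 2) *
      ∫ t in (0:ℝ)..L, ((deriv a t) ^ 2 * (h t) ^ 2 + lam * (a t) ^ 2) }

open Filter Topology

lemma steklovRayleighRev_integrand_intervalIntegrable {a h : ℝ → ℝ} (ha : ContDiff ℝ 1 a)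
    (hh : Continuous h) (lam x y : ℝ) :
    IntervalIntegrable (fun t => (deriv a t) ^ 2 * (h t) ^ 2 + lam * (a t) ^ 2)
      MeasureTheory.volume x y := by
  have h1 := ha.continuous_deriv le_rfl
  have h2 := ha.continuous
  exact Continuous.intervalIntegrable (by fun_prop) _ _

/-- The Rayleigh quotient of any admissible function bounds `σ_rev` from above. -/
lemma steklovRayleighRev_le {lam L : ℝ} (hL : 0 ≤ L) (hlam : 0 ≤ lam) {a : ℝ → ℝ} (h : ℝ → ℝ)
    (ha : ContDiff ℝ 1 a) (ha0 : a 0 = 1) (haL : a L = 0) :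
    steklovRayleighRev lam L h ≤ (1 / (h 0) ^ 2) *
      ∫ t in (0:ℝ)..L, ((deriv a t) ^ 2 * (h t) ^ 2 + lam * (a t) ^ 2) := by
  refine csInf_le ⟨0, ?_⟩ ⟨a, ha, ha0, haL, rfl⟩
  rintro _ ⟨b, -, -, -, rfl⟩
  have := integral_nonneg (μ := MeasureTheory.volume) hL
    (f := fun t => (deriv b t) ^ 2 * (h t) ^ 2 + lam * (b t) ^ 2) (fun t _ => by positivity)
  positivity

/-- A lower bound for the Rayleigh quotients of all admissible functions bounds `σ_rev` from
below. -/
lemma le_steklovRayleighRev {lam L c : ℝ} (hL : L ≠ 0) {h : ℝ → ℝ}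
    (H : ∀ a : ℝ → ℝ, ContDiff ℝ 1 a → a 0 = 1 → a L = 0 → c ≤ (1 / (h 0) ^ 2) *
      ∫ t in (0:ℝ)..L, ((deriv a t) ^ 2 * (h t) ^ 2 + lam * (a t) ^ 2)) :
    c ≤ steklovRayleighRev lam L h := by
  refine le_csInf ⟨_, fun t => 1 - t / L, by fun_prop, by simp, by simp [hL], rfl⟩ ?_
  rintro _ ⟨a, ha, ha0, haL, rfl⟩
  exact H a ha ha0 haL

lemma integral_pow_mul_sub_sq (L : ℝ) (k : ℕ) :
    ∫ t in (0:ℝ)..L, t ^ (2 * k) * (L - t) ^ 2 =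
      L ^ (2 * k + 3) * (2 / ((2 * k + 1) * (2 * k + 2) * (2 * k + 3))) := by
  have e : ∀ t : ℝ, t ^ (2 * k) * (L - t) ^ 2 =
      L ^ 2 * t ^ (2 * k) - 2 * L * t ^ (2 * k + 1) + t ^ (2 * k + 2) := fun t => by ring
  simp_rw [e]
  rw [integral_add, integral_sub, integral_const_mul, integral_const_mul, integral_pow,
    integral_pow, integral_pow]
  · push_cast
    simp only [ne_eq, Nat.add_eq_zero_iff, one_ne_zero, and_false, not_false_eq_true, zero_pow,
      sub_zero]
    field_simp
    ring
  all_goals exact Continuous.intervalIntegrable (by fun_prop) _ _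

/-- The weighted Dirichlet energy of `1 - (t / L) ^ (k + 1)` tends to zero, whence
`σ_rev(λ, h, L) ≤ λ L / h(0)²`. -/
lemma steklovRayleighRev_le_mul_div {lam L : ℝ} (hL : 0 < L) (hlam : 0 ≤ lam) {h : ℝ → ℝ}
    (hh : ContDiff ℝ 1 h) (hhL : h L = 0) :
    steklovRayleighRev lam L h ≤ lam * L / (h 0) ^ 2 := by
  obtain ⟨C, hC⟩ : ∃ C, ∀ t ∈ Icc 0 L, |h t| ≤ C * (L - t) := by
    obtain ⟨C, hC⟩ := isCompact_Icc.exists_bound_of_continuousOn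
      (hh.continuous_deriv le_rfl).continuousOn (s := Icc 0 L)
    refine ⟨C, fun t ht => ?_⟩
    have := (convex_Icc 0 L).norm_image_sub_le_of_norm_deriv_le
      (fun x _ => hh.differentiable one_ne_zero x) hC (right_mem_Icc.2 hL.le) ht
    rw [hhL, sub_zero, Real.norm_eq_abs, Real.norm_eq_abs, abs_sub_comm t L,
      abs_of_nonneg (sub_nonneg.2 ht.2)] at this
    exact this
  have key (k : ℕ) : steklovRayleighRev lam L h ≤
      1 / (h 0) ^ 2 * (C ^ 2 * L * (1 / ((k : ℝ) + 1)) + lam * L) := by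
    have ha : ContDiff ℝ 1 fun t : ℝ => 1 - (t / L) ^ (k + 1) := by fun_prop
    refine (steklovRayleighRev_le hL.le hlam h ha (by simp) (by simp [hL.ne'])).trans ?_
    gcongr
    have hd (t : ℝ) : deriv (fun t : ℝ => 1 - (t / L) ^ (k + 1)) t =
        -((k + 1) * t ^ k / L ^ (k + 1)) := by
      have := ((((hasDerivAt_id t).div_const L).pow (k + 1)).const_sub 1).deriv
      refine this.trans ?_
      simp only [id, Nat.add_sub_cancel, Nat.cast_add, Nat.cast_one, div_pow]
      field_simp
      ring
    calc ∫ t in (0:ℝ)..L, ((deriv (fun t : ℝ => 1 - (t / L) ^ (k + 1)) t) ^ 2 * (h t) ^ 2 +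
          lam * (1 - (t / L) ^ (k + 1)) ^ 2)
        ≤ ∫ t in (0:ℝ)..L, (C ^ 2 * (k + 1) ^ 2 / L ^ (2 * k + 2) *
            (t ^ (2 * k) * (L - t) ^ 2) + lam) := by
          refine integral_mono_on hL.le
            (steklovRayleighRev_integrand_intervalIntegrable ha hh.continuous _ _ _)
            (Continuous.intervalIntegrable (by fun_prop) _ _) fun t ht => ?_
          have h1 : (h t) ^ 2 ≤ (C * (L - t)) ^ 2 := sq_le_sq' (abs_le.1 (hC t ht)).1
            (abs_le.1 (hC t ht)).2
          have h2 : (1 - (t / L) ^ (k + 1)) ^ 2 ≤ 1 := by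
            have h3 : t / L ≤ 1 := (div_le_one hL).2 ht.2
            have h4 : 0 ≤ t / L := div_nonneg ht.1 hL.le
            have h5 := pow_le_one₀ (n := k + 1) h4 h3
            have h6 := pow_nonneg h4 (k + 1)
            nlinarith
          rw [hd]
          refine add_le_add ?_ (mul_le_of_le_one_right hlam h2)
          calc _ ≤ (-((k + 1) * t ^ k / L ^ (k + 1))) ^ 2 * (C * (L - t)) ^ 2 := by gcongr
            _ = _ := by field_simp; ring
      _ = C ^ 2 * L * ((k + 1) / ((2 * k + 1) * (2 * k + 3))) + lam * L := by
          rw [integral_add (Continuous.intervalIntegrable (by fun_prop) _ _)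
            (Continuous.intervalIntegrable (by fun_prop) _ _), integral_const_mul,
            integral_pow_mul_sub_sq, integral_const]
          simp only [smul_eq_mul, sub_zero]
          have : (2 * (k : ℝ) + 2) = 2 * (k + 1) := by ring
          rw [this]
          field_simp
          ring
      _ ≤ _ := by
          gcongr ?_ * ?_ + _
          rw [div_le_div_iff₀ (by positivity) (by positivity)]
          nlinarith [Nat.cast_nonneg (α := ℝ) k]
  have lim := ((tendsto_one_div_add_atTop_nhds_zero_nat.const_mul (C ^ 2 * L)).add_const
    (lam * L)).const_mul (1 / (h 0) ^ 2)
  refine (ge_of_tendsto' lim key).trans (le_of_eq ?_)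
  ring

/-- By homogeneity in `λ`, the quotient `σ_rev(λ) / λ` is nonincreasing. -/
lemma steklovRayleighRev_le_div_mul {lam lam' L : ℝ} (hL : 0 < L) (hlam : 0 < lam)
    (hle : lam ≤ lam') {h : ℝ → ℝ} (hh : Continuous h) :
    steklovRayleighRev lam' L h ≤ lam' / lam * steklovRayleighRev lam L h := by
  have hlam' := hlam.trans_le hle
  rw [← div_le_iff₀' (by positivity)]
  refine le_steklovRayleighRev hL.ne' fun a ha ha0 haL => ?_
  rw [div_le_iff₀' (by positivity)]
  refine (steklovRayleighRev_le hL.le hlam'.le h ha ha0 haL).trans ?_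
  rw [mul_left_comm, ← integral_const_mul (lam' / lam)]
  refine mul_le_mul_of_nonneg_left ?_ (by positivity)
  refine integral_mono_on hL.le
    (steklovRayleighRev_integrand_intervalIntegrable ha hh _ _ _)
    ((steklovRayleighRev_integrand_intervalIntegrable ha hh _ _ _).const_mul _) fun t _ => ?_
  have h1 : 1 ≤ lam' / lam := (one_le_div hlam).2 hle
  have h2 : lam' / lam * lam = lam' := div_mul_cancel₀ _ hlam.ne'
  rw [mul_add, ← mul_assoc _ lam, h2]
  exact add_le_add_left (le_mul_of_one_le_left (by positivity) h1) _

lemma steklovRayleighRev_gap_le {lam lam' L : ℝ} (hL : 0 < L) (hlam : 0 < lam)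
    (hle : lam ≤ lam') {h : ℝ → ℝ} (hh : ContDiff ℝ 1 h) (hhL : h L = 0) :
    steklovRayleighRev lam' L h - steklovRayleighRev lam L h ≤
      L * (lam' - lam) / (h 0) ^ 2 := by
  have h1 := steklovRayleighRev_le_div_mul hL hlam hle hh.continuous
  have h2 := steklovRayleighRev_le_mul_div hL hlam.le hh hhL
  calc _ ≤ (lam' - lam) / lam * steklovRayleighRev lam L h := by
        rw [sub_div, div_self hlam.ne']; linarith
    _ ≤ (lam' - lam) / lam * (lam * L / (h 0) ^ 2) := by
        have := sub_nonneg.2 hle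
        gcongr
    _ = _ := by field_simp

/-- For the warping function `h(t) = (L - t) / u(t)`, completing the square bounds `σ_rev` from
below with an error controlled by `∫ u²`. -/
lemma le_steklovRayleighRev_div {lam L : ℝ} (hL : 0 < L) (hlam : 0 ≤ lam) {u : ℝ → ℝ}
    (hu : Continuous u) (hpos : ∀ t, 0 < u t) :
    1 / (L / u 0) ^ 2 * (lam * L - lam ^ 2 * ∫ t in (0:ℝ)..L, (u t) ^ 2) ≤
      steklovRayleighRev lam L fun t => (L - t) / u t := by
  refine le_steklovRayleighRev hL.ne' fun a ha ha0 _ => ?_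
  have hda := ha.continuous_deriv le_rfl
  have hca := ha.continuous
  have hh : Continuous fun t => (L - t) / u t :=
    (continuous_const.sub continuous_id).div hu fun t => (hpos t).ne'
  have parts : ∫ t in (0:ℝ)..L, ((a t - 1) - deriv a t * (L - t)) = 0 := by
    rw [integral_eq_sub_of_hasDerivAt (f := fun t => (a t - 1) * (t - L))]
    · simp [ha0]
    · intro t _
      exact (((ha.differentiable one_ne_zero t).hasDerivAt.sub_const 1).mul
        ((hasDerivAt_id t).sub_const L)).congr_deriv (by simp only [id]; ring)
    · exact Continuous.intervalIntegrable (by fun_prop) _ _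
  rw [sub_zero]
  gcongr
  calc lam * L - lam ^ 2 * ∫ t in (0:ℝ)..L, (u t) ^ 2
      = ∫ t in (0:ℝ)..L, (lam - lam ^ 2 * (u t) ^ 2 +
          2 * lam * ((a t - 1) - deriv a t * (L - t))) := by
        rw [integral_add (Continuous.intervalIntegrable (by fun_prop) _ _)
          (Continuous.intervalIntegrable (by fun_prop) _ _),
          integral_sub (Continuous.intervalIntegrable (by fun_prop) _ _)
          (Continuous.intervalIntegrable (by fun_prop) _ _), integral_const_mul,
          integral_const_mul, parts, integral_const]
        simp only [smul_eq_mul]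
        ring
    _ ≤ _ := by
        refine integral_mono_on hL.le (Continuous.intervalIntegrable (by fun_prop) _ _)
          (steklovRayleighRev_integrand_intervalIntegrable ha hh _ _ _) fun t _ => ?_
        have e : deriv a t * (L - t) = deriv a t * ((L - t) / u t) * u t := by
          have := (hpos t).ne'
          field_simp
        rw [e]
        nlinarith [sq_nonneg (deriv a t * ((L - t) / u t) + lam * u t),
          mul_nonneg hlam (sq_nonneg (a t - 1))]

/-- There are smooth positive functions with prescribed endpoint values and small `L²` norm. -/
lemma exists_contDiff_pos_integral_sq_le {L p : ℝ} (hL : 0 < L) (hp : 0 < p) (n : ℕ) :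
    ∃ u : ℝ → ℝ, ContDiff ℝ (⊤ : ℕ∞) u ∧ (∀ t, 0 < u t) ∧ u 0 = p ∧ u L = 1 ∧
      ∫ t in (0:ℝ)..L, (u t) ^ 2 ≤ 2 * (p ^ 2 + 1) * L * (1 / ((n : ℝ) + 1)) := by
  refine ⟨fun t => p * (1 - t / L) ^ (2 * (n + 1)) + (t / L) ^ (2 * (n + 1)), by fun_prop,
    fun t => ?_, by simp, by simp [hL.ne'], ?_⟩
  · have h1 : 0 ≤ (t / L) ^ (2 * (n + 1)) := (even_two_mul _).pow_nonneg _
    have h2 : 0 ≤ (1 - t / L) ^ (2 * (n + 1)) := (even_two_mul _).pow_nonneg _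
    rcases eq_or_ne t 0 with rfl | ht
    · simpa using hp
    · have : 0 < (t / L) ^ (2 * (n + 1)) := (even_two_mul _).pow_pos (div_ne_zero ht hL.ne')
      positivity
  · set m := 2 * (2 * (n + 1)) with hm
    calc ∫ t in (0:ℝ)..L, (p * (1 - t / L) ^ (2 * (n + 1)) + (t / L) ^ (2 * (n + 1))) ^ 2
        ≤ ∫ t in (0:ℝ)..L, (2 * p ^ 2 * (1 - t / L) ^ m + 2 * (t / L) ^ m) := by
          refine integral_mono_on hL.le (Continuous.intervalIntegrable (by fun_prop) _ _)
            (Continuous.intervalIntegrable (by fun_prop) _ _) fun t _ => ?_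
          have e (x : ℝ) : x ^ m = (x ^ (2 * (n + 1))) ^ 2 := by rw [hm, pow_mul']
          rw [e, e]
          nlinarith [sq_nonneg (p * (1 - t / L) ^ (2 * (n + 1)) - (t / L) ^ (2 * (n + 1)))]
      _ = 2 * (p ^ 2 + 1) * L * (1 / ((m : ℝ) + 1)) := by
          rw [integral_add (Continuous.intervalIntegrable (by fun_prop) _ _)
            (Continuous.intervalIntegrable (by fun_prop) _ _), integral_const_mul,
            integral_const_mul, integral_comp_div (fun x => (1 - x) ^ m) hL.ne',
            integral_comp_div (fun x => x ^ m) hL.ne',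
            integral_comp_sub_left (fun x => x ^ m)]
          simp [hL.ne']
          ring
      _ ≤ _ := by
          have : (n : ℝ) ≤ m := by rw [hm]; push_cast; linarith
          gcongr

theorem steklovRev_gap_sup (L h₀ : ℝ) (hL : 0 < L) (hh₀ : 0 < h₀)
    (j : ℕ) (hj : 1 ≤ j) :
    sSup { x : ℝ | ∃ h : ℝ → ℝ, ContDiff ℝ (⊤ : ℕ∞) h ∧
        (∀ t ∈ Ico (0:ℝ) L, 0 < h t) ∧ h L = 0 ∧ deriv h L = -1 ∧ h 0 = h₀ ∧
        x = steklovRayleighRev (((j : ℝ) + 1) * ((j : ℝ) + 2)) L h -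
            steklovRayleighRev ((j : ℝ) * ((j : ℝ) + 1)) L h } =
      L * (((j : ℝ) + 1) * ((j : ℝ) + 2) - (j : ℝ) * ((j : ℝ) + 1)) / h₀ ^ 2 := by
  have hj' : (1 : ℝ) ≤ j := by exact_mod_cast hj
  set lam : ℝ := (j : ℝ) * ((j : ℝ) + 1) with hlam_def
  set lam' : ℝ := ((j : ℝ) + 1) * ((j : ℝ) + 2) with hlam'_def
  have hlam : 0 < lam := by positivity
  have hle : lam ≤ lam' := by rw [hlam_def, hlam'_def]; nlinarith
  set S := { x : ℝ | ∃ h : ℝ → ℝ, ContDiff ℝ (⊤ : ℕ∞) h ∧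
        (∀ t ∈ Ico (0:ℝ) L, 0 < h t) ∧ h L = 0 ∧ deriv h L = -1 ∧ h 0 = h₀ ∧
        x = steklovRayleighRev lam' L h - steklovRayleighRev lam L h } with hS
  have upper : ∀ x ∈ S, x ≤ L * (lam' - lam) / h₀ ^ 2 := by
    rintro _ ⟨h, hh, -, hhL, -, hh0, rfl⟩
    rw [← hh0]
    exact steklovRayleighRev_gap_le hL hlam hle (hh.of_le (by exact_mod_cast le_top)) hhL
  have lower (n : ℕ) : ∃ x ∈ S, L * (lam' - lam) / h₀ ^ 2 -
      lam' ^ 2 / h₀ ^ 2 * (2 * ((L / h₀) ^ 2 + 1) * L) * (1 / ((n : ℝ) + 1)) ≤ x := by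
    obtain ⟨u, hu, hpos, hu0, huL, hint⟩ :=
      exists_contDiff_pos_integral_sq_le hL (div_pos hL hh₀) n
    have hsm : ContDiff ℝ (⊤ : ℕ∞) fun t => (L - t) / u t :=
      (contDiff_const.sub contDiff_id).div hu fun t => (hpos t).ne'
    refine ⟨_, ⟨fun t => (L - t) / u t, hsm,
      fun t ht => div_pos (sub_pos.2 ht.2) (hpos t), by simp, ?_, ?_, rfl⟩, ?_⟩
    · have hdu := (hu.differentiable (by simp) L).hasDerivAt
      have := (((hasDerivAt_id L).const_sub L).div hdu (hpos L).ne').deriv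
      simpa [huL, Pi.div_def] using this
    · simp only [hu0, sub_zero]
      field_simp
    · have h1 := le_steklovRayleighRev_div hL (hlam.le.trans hle) hu.continuous hpos
      have h2 := steklovRayleighRev_le_mul_div hL hlam.le
        (hsm.of_le (by exact_mod_cast le_top)) (by simp)
      have e : L / (L / h₀) = h₀ := by field_simp
      simp only [hu0, sub_zero, e] at h1 h2
      have h3 := mul_le_mul_of_nonneg_left hint (show 0 ≤ lam' ^ 2 / h₀ ^ 2 by positivity)
      calc _ = lam' * L / h₀ ^ 2 - lam' ^ 2 / h₀ ^ 2 *
              (2 * ((L / h₀) ^ 2 + 1) * L * (1 / ((n : ℝ) + 1))) - lam * L / h₀ ^ 2 := by ring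
        _ ≤ 1 / h₀ ^ 2 * (lam' * L - lam' ^ 2 * ∫ t in (0:ℝ)..L, (u t) ^ 2) -
              lam * L / h₀ ^ 2 := by
            have e' (I : ℝ) : 1 / h₀ ^ 2 * (lam' * L - lam' ^ 2 * I) =
                lam' * L / h₀ ^ 2 - lam' ^ 2 / h₀ ^ 2 * I := by ring
            rw [e']
            linarith
        _ ≤ _ := by linarith
  have bdd : BddAbove S := ⟨_, upper⟩
  refine le_antisymm (csSup_le ((lower 0).imp fun _ hx => hx.1) upper) ?_
  have lim := (tendsto_one_div_add_atTop_nhds_zero_nat.const_mul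
    (lam' ^ 2 / h₀ ^ 2 * (2 * ((L / h₀) ^ 2 + 1) * L))).const_sub (L * (lam' - lam) / h₀ ^ 2)
  rw [mul_zero, sub_zero] at lim
  refine le_of_tendsto' lim fun n => ?_
  obtain ⟨x, hx, hle'⟩ := lower n
  exact hle'.trans (le_csSup bdd hx)
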